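/- Given a phrase structure ω-grammar (respectively, a context-sensitive ω-grammar) G, there can be constructed a phrase structure ω-grammar (respectively, a context-sensitive ω-grammar) G' with $-boundary such that L_{σ,ρ,nl}(G) = L_{σ,ρ,nl}(G') for every σ ∈ {ran, inf} and ρ ∈ {⊓, ⊆, =}. -/

import Mathlib

namespace OmegaFormal

/-- σ component of an acceptance mode: `ran` (occurs at least once)
or `inf` (occurs infinitely often). -/
inductive AccSigma | ran | inf
deriving DecidableEq

/-- ρ component of an acceptance mode: `cap` (nonempty intersection, ⊓),
`sub` (⊆) or `eq` (=). -/
inductive AccRho | cap | sub | eq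
deriving DecidableEq

/-- derivation mode: leftmost (`l`) or normal (`nl`). -/
inductive DerivMode | l | nl
deriving DecidableEq

/-- `sigmaSet σ f` is ran(f) resp. inf(f). -/
def sigmaSet {Q : Type _} : AccSigma → (ℕ → Q) → Set Q
  | .ran, f => Set.range f
  | .inf, f => {q | ∀ n : ℕ, ∃ m : ℕ, n ≤ m ∧ f m = q}

/-- the binary relation denoted by ρ. -/
def rhoRel {Q : Type _} : AccRho → Set Q → Set Q → Prop
  | .cap, A, B => (A ∩ B).Nonempty
  | .sub, A, B => A ⊆ B
  | .eq,  A, B => A = B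

/-- f is (σ,ρ)-accepting w.r.t. the set 𝓕 of designated sets. -/
def IsAccepting {Q : Type _} (σ : AccSigma) (ρ : AccRho) (𝓕 : Set (Set Q)) (f : ℕ → Q) : Prop :=
  ∃ F ∈ 𝓕, rhoRel ρ (sigmaSet σ f) F

/-- the finite word `l` coincides with the prefix of the ω-word `u`. -/
def MatchesPrefix {T : Type _} (l : List T) (u : ℕ → T) : Prop :=
  ∀ (k : ℕ) (h : k < l.length), l.get ⟨k, h⟩ = u k

/-- the maximal terminal prefix of a sentential form. -/
def termPrefix {N T : Type _} : List (N ⊕ T) → List T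
  | [] => []
  | (Sum.inl _) :: _ => []
  | (Sum.inr a) :: l => a :: termPrefix l

/-- A phrase structure ω-grammar `G = (N, T, P, S, 𝓕)`:
`N` nonterminals, `T` terminals, `P` named productions `p : lhs p → rhs p`
with `lhs p ∈ N⁺`, `rhs p ∈ (N ∪ T)*`, start symbol, and
production repetition sets `acc ⊆ 2^P`. -/
structure OmegaPSG (T : Type) where
  N : Type
  [fintypeN : Fintype N]
  P : Type
  [fintypeP : Fintype P]
  lhs : P → List N
  lhs_ne : ∀ p : P, lhs p ≠ []
  rhs : P → List (N ⊕ T)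
  start : N
  acc : Set (Set P)

namespace OmegaPSG

variable {T : Type} (G : OmegaPSG T)

/-- one (normal) rewriting step using production p. -/
def Step (p : G.P) (x y : List (G.N ⊕ T)) : Prop :=
  ∃ u v : List (G.N ⊕ T),
    x = u ++ (G.lhs p).map Sum.inl ++ v ∧ y = u ++ G.rhs p ++ v

/-- one leftmost rewriting step: the rewritten occurrence starts at the
leftmost nonterminal, i.e. everything to its left is terminal. -/
def LStep (p : G.P) (x y : List (G.N ⊕ T)) : Prop :=
  ∃ u v : List (G.N ⊕ T), (∀ s ∈ u, ∃ a : T, s = Sum.inr a) ∧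
    x = u ++ (G.lhs p).map Sum.inl ++ v ∧ y = u ++ G.rhs p ++ v

def StepOf : DerivMode → G.P → List (G.N ⊕ T) → List (G.N ⊕ T) → Prop
  | .l => G.LStep
  | .nl => G.Step

/-- `L_{σ,ρ,π}(G)`: ω-words admitting an infinite π-derivation from S whose
growing terminal prefixes spell the word and whose production sequence is
(σ,ρ)-accepting w.r.t. `G.acc`. -/
def Lang (σ : AccSigma) (ρ : AccRho) (π : DerivMode) : Set (ℕ → T) :=
  {u | ∃ (s : ℕ → List (G.N ⊕ T)) (d : ℕ → G.P),
    s 0 = [Sum.inl G.start] ∧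
    (∀ i : ℕ, G.StepOf π (d i) (s i) (s (i + 1))) ∧
    (∀ n : ℕ, ∃ i : ℕ, n ≤ (termPrefix (s i)).length) ∧
    (∀ i : ℕ, MatchesPrefix (termPrefix (s i)) u) ∧
    IsAccepting σ ρ G.acc d}

/-- context-free: every left-hand side is a single nonterminal. -/
def IsCFG : Prop := ∀ p : G.P, (G.lhs p).length = 1

/-- context-sensitive (monotonic): `|β| ≥ |α|` for every production. -/
def IsCSG : Prop := ∀ p : G.P, (G.lhs p).length ≤ (G.rhs p).length

/-- right linear: productions of the form `A → uB` or `A → u`, `u ∈ T*`. -/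
def IsRLG : Prop :=
  ∀ p : G.P, (G.lhs p).length = 1 ∧
    ∃ (w : List T) (B : Option G.N),
      G.rhs p = w.map Sum.inr ++ B.toList.map Sum.inl

/-- `G` is a grammar with `$`-boundary (PSG version): with `$` = `dollar`,
`S` = `S'`, every production has one of the forms
(1) α → β, α,β ∈ N⁺ (N = nonterminals other than `$`, `S`),
(2) S → $α, α ∈ N⁺, (3) $A → a$, (4) A → ε. -/
def HasDollarBoundary (dollar S' : G.N) : Prop :=
  dollar ≠ S' ∧ G.start = S' ∧
  ∀ p : G.P,
    ((dollar ∉ G.lhs p ∧ S' ∉ G.lhs p) ∧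
      ∃ β : List G.N, β ≠ [] ∧ dollar ∉ β ∧ S' ∉ β ∧ G.rhs p = β.map Sum.inl) ∨
    (G.lhs p = [S'] ∧ ∃ α : List G.N, α ≠ [] ∧ dollar ∉ α ∧ S' ∉ α ∧
      G.rhs p = Sum.inl dollar :: α.map Sum.inl) ∨
    (∃ A : G.N, A ≠ dollar ∧ A ≠ S' ∧ G.lhs p = [dollar, A] ∧
      ∃ a : T, G.rhs p = [Sum.inr a, Sum.inl dollar]) ∨
    (∃ A : G.N, A ≠ dollar ∧ A ≠ S' ∧ G.lhs p = [A] ∧ G.rhs p = [])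

/-- `G` is a grammar with `$`-boundary (CSG version): forms (1)-(3) only,
with `|α| ≤ |β|` in form (1). -/
def HasDollarBoundaryCSG (dollar S' : G.N) : Prop :=
  dollar ≠ S' ∧ G.start = S' ∧
  ∀ p : G.P,
    ((dollar ∉ G.lhs p ∧ S' ∉ G.lhs p) ∧
      ∃ β : List G.N, β ≠ [] ∧ dollar ∉ β ∧ S' ∉ β ∧ (G.lhs p).length ≤ β.length ∧
        G.rhs p = β.map Sum.inl) ∨
    (G.lhs p = [S'] ∧ ∃ α : List G.N, α ≠ [] ∧ dollar ∉ α ∧ S' ∉ α ∧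
      G.rhs p = Sum.inl dollar :: α.map Sum.inl) ∨
    (∃ A : G.N, A ≠ dollar ∧ A ≠ S' ∧ G.lhs p = [dollar, A] ∧
      ∃ a : T, G.rhs p = [Sum.inr a, Sum.inl dollar])

end OmegaPSG

/-- `𝓛_{σ,ρ,π}(X)` for the family `X` of ω-grammars over `T` satisfying `C`. -/
def GLang (T : Type) (C : OmegaPSG T → Prop) (σ : AccSigma) (ρ : AccRho) (π : DerivMode) :
    Set (Set (ℕ → T)) :=
  {L | ∃ G : OmegaPSG T, C G ∧ L = G.Lang σ ρ π}

/-- number of non-ε labels among `b 0, …, b (i-1)`. -/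
def someCount {A : Type _} (b : ℕ → Option A) (i : ℕ) : ℕ :=
  ((Finset.range i).filter fun j => (b j).isSome = true).card

/-- the (ε-allowing) label sequence `b` concatenates to the ω-word `u`. -/
def Spells {A : Type _} (b : ℕ → Option A) (u : ℕ → A) : Prop :=
  (∀ n : ℕ, ∃ i : ℕ, n ≤ someCount b i) ∧
  ∀ i : ℕ, ∀ a : A, b i = some a → a = u (someCount b i)

/-- A finite state ω-automaton `(Q, Σ, δ, q₀, 𝓕)`. -/
structure OmegaFSA (Sig : Type) where
  Q : Type
  [fintypeQ : Fintype Q]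
  init : Q
  trans : Q → Option Sig → Q → Prop
  acc : Set (Set Q)

/-- `L_{σ,ρ}(A)` for a finite state ω-automaton. -/
def OmegaFSA.Lang {Sig : Type} (A : OmegaFSA Sig) (σ : AccSigma) (ρ : AccRho) :
    Set (ℕ → Sig) :=
  {u | ∃ (r : ℕ → A.Q) (b : ℕ → Option Sig),
    r 0 = A.init ∧ (∀ i : ℕ, A.trans (r i) (b i) (r (i + 1))) ∧
    Spells b u ∧ IsAccepting σ ρ A.acc r}

/-- `𝓛_{σ,ρ}(ω-FSA)`. -/
def FSALang (Sig : Type) (σ : AccSigma) (ρ : AccRho) : Set (Set (ℕ → Sig)) :=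
  {L | ∃ A : OmegaFSA Sig, L = A.Lang σ ρ}

/-- A pushdown ω-automaton `(Q, Σ, Γ, δ, q₀, Z₀, 𝓕)`. -/
structure OmegaPDA (Sig : Type) where
  Q : Type
  [fintypeQ : Fintype Q]
  Γ : Type
  [fintypeΓ : Fintype Γ]
  init : Q
  Z0 : Γ
  trans : Q → Option Sig → Γ → Q → List Γ → Prop
  acc : Set (Set Q)

/-- `L_{σ,ρ}(D)` for a pushdown ω-automaton. -/
def OmegaPDA.Lang {Sig : Type} (D : OmegaPDA Sig) (σ : AccSigma) (ρ : AccRho) :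
    Set (ℕ → Sig) :=
  {u | ∃ (q : ℕ → D.Q) (st : ℕ → List D.Γ) (b : ℕ → Option Sig),
    q 0 = D.init ∧ st 0 = [D.Z0] ∧
    (∀ i : ℕ, ∃ (Z : D.Γ) (γ rest : List D.Γ),
      st i = Z :: rest ∧ D.trans (q i) (b i) Z (q (i + 1)) γ ∧ st (i + 1) = γ ++ rest) ∧
    Spells b u ∧ IsAccepting σ ρ D.acc q}

/-- `𝓛_{σ,ρ}(ω-PDA)`. -/
def PDALang (Sig : Type) (σ : AccSigma) (ρ : AccRho) : Set (Set (ℕ → Sig)) :=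
  {L | ∃ D : OmegaPDA Sig, L = D.Lang σ ρ}

/-- tape head moves. -/
inductive Move | L | R | S
deriving DecidableEq

def moveHead : Move → ℕ → ℕ
  | .L, n => n - 1
  | .R, n => n + 1
  | .S, n => n

/-- A single-tape Turing ω-machine `(Q, Σ, Γ, δ, q₀, 𝓕)` (Σ ⊆ Γ via `embed`). -/
structure OmegaTM (Sig : Type) where
  Q : Type
  [fintypeQ : Fintype Q]
  Γ : Type
  [fintypeΓ : Fintype Γ]
  embed : Sig → Γ
  embed_inj : Function.Injective embed
  init : Q
  trans : Q → Γ → Q → Γ → Move → Prop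
  acc : Set (Set Q)

/-- `L_{σ,ρ}(M)`: ω-words admitting a complete non-oscillating run whose state
sequence is (σ,ρ)-accepting. -/
def OmegaTM.Lang {Sig : Type} (M : OmegaTM Sig) (σ : AccSigma) (ρ : AccRho) :
    Set (ℕ → Sig) :=
  {u | ∃ (q : ℕ → M.Q) (tape : ℕ → ℕ → M.Γ) (pos : ℕ → ℕ),
    q 0 = M.init ∧ (∀ n : ℕ, tape 0 n = M.embed (u n)) ∧ pos 0 = 0 ∧
    (∀ i : ℕ, ∃ (g : M.Γ) (m : Move),
      M.trans (q i) (tape i (pos i)) (q (i + 1)) g m ∧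
      tape (i + 1) = Function.update (tape i) (pos i) g ∧
      pos (i + 1) = moveHead m (pos i)) ∧
    (∀ n : ℕ, ∃ i : ℕ, n ≤ pos i) ∧
    (∀ n : ℕ, ∃ i0 : ℕ, ∀ i : ℕ, i0 ≤ i → pos i ≠ n) ∧
    IsAccepting σ ρ M.acc q}

/-- `𝓛_{σ,ρ}(ω-TM)`. -/
def TMLang (Sig : Type) (σ : AccSigma) (ρ : AccRho) : Set (Set (ℕ → Sig)) :=
  {L | ∃ M : OmegaTM Sig, L = M.Lang σ ρ}

/-- An m-tape Turing ω-machine. -/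
structure OmegaMTM (m : ℕ) (Sig : Type) where
  Q : Type
  [fintypeQ : Fintype Q]
  Γ : Type
  [fintypeΓ : Fintype Γ]
  embed : Sig → Γ
  embed_inj : Function.Injective embed
  blank : Γ
  init : Q
  trans : Q → (Fin m → Γ) → Q → (Fin m → Γ) → (Fin m → Move) → Prop
  acc : Set (Set Q)

/-- `L_{σ,ρ}(M)` for an m-tape Turing ω-machine (`hm : 0 < m`; the input is on
the first tape, the other tapes are initially blank; the run must be complete
and non-oscillating on the first tape). -/
def OmegaMTM.Lang {m : ℕ} {Sig : Type} (M : OmegaMTM m Sig) (hm : 0 < m)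
    (σ : AccSigma) (ρ : AccRho) : Set (ℕ → Sig) :=
  {u | ∃ (q : ℕ → M.Q) (tape : ℕ → Fin m → ℕ → M.Γ) (pos : ℕ → Fin m → ℕ),
    q 0 = M.init ∧
    (∀ n : ℕ, tape 0 ⟨0, hm⟩ n = M.embed (u n)) ∧
    (∀ j : Fin m, j ≠ ⟨0, hm⟩ → ∀ n : ℕ, tape 0 j n = M.blank) ∧
    (∀ j : Fin m, pos 0 j = 0) ∧
    (∀ i : ℕ, ∃ (g : Fin m → M.Γ) (mv : Fin m → Move),
      M.trans (q i) (fun j => tape i j (pos i j)) (q (i + 1)) g mv ∧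
      (∀ j : Fin m, tape (i + 1) j = Function.update (tape i j) (pos i j) (g j)) ∧
      (∀ j : Fin m, pos (i + 1) j = moveHead (mv j) (pos i j))) ∧
    (∀ n : ℕ, ∃ i : ℕ, n ≤ pos i ⟨0, hm⟩) ∧
    (∀ n : ℕ, ∃ i0 : ℕ, ∀ i : ℕ, i0 ≤ i → pos i ⟨0, hm⟩ ≠ n) ∧
    IsAccepting σ ρ M.acc q}

/-- `𝓛_{σ,ρ}(m-ω-TM)`. -/
def MTMLang (Sig : Type) (m : ℕ) (hm : 0 < m) (σ : AccSigma) (ρ : AccRho) :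
    Set (Set (ℕ → Sig)) :=
  {L | ∃ M : OmegaMTM m Sig, L = M.Lang hm σ ρ}

/-- the ω-language `{aⁿbⁿ | n ≥ 1}^ω` over the alphabet `Bool`
(`false` = a, `true` = b). -/
def abLang : Set (ℕ → Bool) :=
  {u | ∃ n : ℕ → ℕ, (∀ i : ℕ, 1 ≤ n i) ∧
    ∀ i k : ℕ, k < 2 * n i →
      u ((∑ j ∈ Finset.range i, 2 * n j) + k) = decide (n i ≤ k)}

end OmegaFormal
open OmegaFormal


namespace OmegaFormal

attribute [instance] OmegaPSG.fintypeN OmegaPSG.fintypeP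

/-! ### Infinite sequences over finite sets -/

theorem exists_mem_sigmaSet_inf {Q : Type*} [Finite Q] {f : ℕ → Q} {R : Q → Prop}
    (h : ∀ n, ∃ m, n ≤ m ∧ R (f m)) : ∃ q ∈ sigmaSet .inf f, R q := by
  by_contra! hc
  have hb : ∀ q, ∃ n, R q → ∀ m, n ≤ m → f m ≠ q := by
    intro q
    by_cases hq : R q
    · by_contra! hn
      exact hc q (fun n => (hn n).2) hq
    · exact ⟨0, fun h => absurd h hq⟩
  choose b hb using hb
  obtain ⟨M, hM⟩ := (Set.finite_range b).bddAbove
  obtain ⟨m, hm, hR⟩ := h M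
  exact hb (f m) hR m ((hM ⟨f m, rfl⟩).trans hm) rfl

theorem sigmaSet_inf_subset_range {Q : Type*} (f : ℕ → Q) :
    sigmaSet .inf f ⊆ Set.range f := by
  intro q hq
  obtain ⟨m, -, hm⟩ := hq 0
  exact ⟨m, hm⟩

theorem sigmaSet_subset_range {Q : Type*} (σ : AccSigma) (f : ℕ → Q) :
    sigmaSet σ f ⊆ Set.range f := by
  cases σ
  · exact subset_rfl
  · exact sigmaSet_inf_subset_range f

theorem exists_mem_sigmaSet {Q : Type*} [Finite Q] (σ : AccSigma) {f : ℕ → Q} {R : Q → Prop}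
    (h : ∀ n, ∃ m, n ≤ m ∧ R (f m)) : ∃ q ∈ sigmaSet σ f, R q := by
  obtain ⟨q, hq, hR⟩ := exists_mem_sigmaSet_inf h
  cases σ
  · exact ⟨q, sigmaSet_inf_subset_range f hq, hR⟩
  · exact ⟨q, hq, hR⟩

/-- `f` and `g` have the same letters, and the same recurring letters, once `f` is read
through the partial map `o`. -/
def SameTrace {Q P : Type*} (o : Q → Option P) (f : ℕ → Q) (g : ℕ → P) : Prop :=
  (∀ p, (∃ i, o (f i) = some p) ↔ ∃ k, g k = p) ∧
  ∀ p, (∀ n, ∃ i, n ≤ i ∧ o (f i) = some p) ↔ ∀ n, ∃ k, n ≤ k ∧ g k = p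

theorem SameTrace.mem_sigmaSet_iff {Q P : Type*} [Finite Q] {o : Q → Option P} {f : ℕ → Q}
    {g : ℕ → P} (h : SameTrace o f g) (σ : AccSigma) (p : P) :
    p ∈ sigmaSet σ g ↔ ∃ q ∈ sigmaSet σ f, o q = some p := by
  cases σ
  · simpa [sigmaSet] using (h.1 p).symm
  · refine (h.2 p).symm.trans
      ⟨fun hp => exists_mem_sigmaSet_inf (R := fun q => o q = some p) hp, ?_⟩
    rintro ⟨q, hq, hp⟩ n
    obtain ⟨m, hm, rfl⟩ := hq n
    exact ⟨m, hm, hp⟩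

/-- Deleting the steps of a run whose label is mapped to `none`. -/
theorem exists_subsequence {X Q P : Type*} (o : Q → Option P) (R : P → X → X → Prop)
    (s : ℕ → X) (d : ℕ → Q)
    (hnone : ∀ i, o (d i) = none → s (i + 1) = s i)
    (hsome : ∀ i p, o (d i) = some p → R p (s i) (s (i + 1)))
    (hinf : ∀ n, ∃ m, n ≤ m ∧ (o (d m)).isSome) :
    ∃ (φ : ℕ → ℕ) (g : ℕ → P), StrictMono φ ∧ s (φ 0) = s 0 ∧
      (∀ k, R (g k) (s (φ k)) (s (φ (k + 1)))) ∧ SameTrace o d g := by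
  classical
  set A : ℕ → Prop := fun i => (o (d i)).isSome with hA
  have hAinf : {i | A i}.Infinite := by
    refine Set.infinite_of_not_bddAbove ?_
    rintro ⟨M, hM⟩
    obtain ⟨m, hm, hs⟩ := hinf (M + 1)
    have := hM (show m ∈ {i | A i} from hs)
    omega
  have hmono := Nat.nth_strictMono hAinf
  have hmem : ∀ k, A (Nat.nth A k) := Nat.nth_mem_of_infinite hAinf
  have hsurj : ∀ i, A i → ∃ k, Nat.nth A k = i := fun i hi => ⟨_, Nat.nth_count hi⟩
  have hconst : ∀ a b, a ≤ b → (∀ i, a ≤ i → i < b → ¬ A i) → s b = s a := by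
    intro a b hab
    induction b, hab using Nat.le_induction with
    | base => intros; rfl
    | succ b hab ih =>
      intro h
      rw [hnone b (by simpa [hA] using h b hab (by omega)),
        ih fun i h1 h2 => h i h1 (by omega)]
  choose g hg using fun k => Option.isSome_iff_exists.mp (hmem k)
  refine ⟨Nat.nth A, g, hmono, ?_, ?_, ?_, ?_⟩
  · refine hconst _ _ (Nat.zero_le _) fun i _ hi hAi => ?_
    obtain ⟨k, rfl⟩ := hsurj i hAi
    exact absurd (hmono.lt_iff_lt.mp hi) (Nat.not_lt_zero _)
  · intro k
    rw [hconst (Nat.nth A k + 1) (Nat.nth A (k + 1)) (hmono (Nat.lt_succ_self k))]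
    · exact hsome _ _ (hg k)
    · intro i h1 h2 hAi
      obtain ⟨j, rfl⟩ := hsurj i hAi
      have := hmono.lt_iff_lt.mp h2
      have := hmono.lt_iff_lt.mp (show Nat.nth A k < Nat.nth A j by omega)
      omega
  · intro p
    constructor
    · rintro ⟨i, hi⟩
      obtain ⟨k, rfl⟩ := hsurj i (by simp [hA, hi])
      exact ⟨k, Option.some_injective _ ((hg k).symm.trans hi)⟩
    · rintro ⟨k, rfl⟩
      exact ⟨_, hg k⟩
  · intro p
    constructor
    · intro h n
      obtain ⟨i, hni, hi⟩ := h (Nat.nth A n)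
      obtain ⟨k, rfl⟩ := hsurj i (by simp [hA, hi])
      exact ⟨k, hmono.le_iff_le.mp hni, Option.some_injective _ ((hg k).symm.trans hi)⟩
    · intro h n
      obtain ⟨k, hk, rfl⟩ := h n
      exact ⟨_, hk.trans (hmono.id_le k), hg k⟩

/-- `LabelledPath R x l y`: the steps of `R` with labels `l` lead from `x` to `y`. -/
inductive LabelledPath {X Q : Type*} (R : Q → X → X → Prop) : X → List Q → X → Prop
  | nil (x : X) : LabelledPath R x [] x
  | cons {q : Q} {x y z : X} {l : List Q} :
      R q x y → LabelledPath R y l z → LabelledPath R x (q :: l) z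

namespace LabelledPath

variable {X Q : Type*} {R : Q → X → X → Prop}

theorem single {q : Q} {x y : X} (h : R q x y) : LabelledPath R x [q] y :=
  .cons h (.nil y)

theorem append {x y z : X} {l m : List Q} (h : LabelledPath R x l y)
    (h' : LabelledPath R y m z) : LabelledPath R x (l ++ m) z := by
  induction h with
  | nil => exact h'
  | cons hs _ ih => exact .cons hs (ih h')

theorem exists_states {x y : X} {l : List Q} (h : LabelledPath R x l y) :
    ∃ t : ℕ → X, t 0 = x ∧ t l.length = y ∧
      ∀ i (hi : i < l.length), R l[i] (t i) (t (i + 1)) := by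
  induction h with
  | nil x => exact ⟨fun _ => x, rfl, rfl, by simp⟩
  | @cons q x y z l hs _ ih =>
    obtain ⟨t, h0, h1, h2⟩ := ih
    refine ⟨fun i => Nat.casesOn i x t, rfl, h1, ?_⟩
    rintro (_ | i) hi
    · simpa [h0] using hs
    · simpa using h2 i (by simpa using hi)

/-- Concatenation of infinitely many nonempty finite paths. -/
theorem exists_concat {c : ℕ → X} {l : ℕ → List Q}
    (h : ∀ k, LabelledPath R (c k) (l k) (c (k + 1))) (hne : ∀ k, l k ≠ []) :
    ∃ (s : ℕ → X) (d : ℕ → Q) (φ : ℕ → ℕ), StrictMono φ ∧ s 0 = c 0 ∧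
      (∀ i, R (d i) (s i) (s (i + 1))) ∧ (∀ k, s (φ k) = c k) ∧
      (∀ i, ∃ k, φ k ≤ i ∧ i < φ (k + 1) ∧ d i ∈ l k) ∧
      ∀ k, ∀ q ∈ l k, ∃ i, φ k ≤ i ∧ d i = q := by
  choose t h0 h1 h2 using fun k => (h k).exists_states
  set φ : ℕ → ℕ := fun k => ∑ j ∈ Finset.range k, (l j).length with hφ
  have hsucc : ∀ k, φ (k + 1) = φ k + (l k).length := fun k => Finset.sum_range_succ _ _
  have hmono : StrictMono φ := strictMono_nat_of_lt_succ fun k => by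
    have := List.length_pos_iff.mpr (hne k)
    rw [hsucc]; omega
  have hex : ∀ i, ∃ k, φ k ≤ i ∧ i < φ (k + 1) := by
    intro i
    have hi : ∃ k, i < φ (k + 1) := ⟨i, hmono.id_le (i + 1)⟩
    classical
    refine ⟨Nat.find hi, ?_, Nat.find_spec hi⟩
    rcases hk : Nat.find hi with _ | k
    · simp [hφ]
    · exact not_lt.mp (Nat.find_min hi (m := k) (by omega))
  choose b hb1 hb2 using hex
  have huniq : ∀ i k, φ k ≤ i → i < φ (k + 1) → b i = k := by
    intro i k hk1 hk2
    have := hmono.lt_iff_lt.mp ((hb1 i).trans_lt hk2)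
    have := hmono.lt_iff_lt.mp (hk1.trans_lt (hb2 i))
    omega
  have hlt : ∀ i, i - φ (b i) < (l (b i)).length := by
    intro i
    have := hb2 i
    have := hb1 i
    rw [hsucc] at *
    omega
  have hstart : ∀ k, t (b (φ k)) (φ k - φ (b (φ k))) = c k := by
    intro k
    rw [huniq (φ k) k le_rfl (hmono (Nat.lt_succ_self k)), Nat.sub_self, h0]
  refine ⟨fun i => t (b i) (i - φ (b i)), fun i => (l (b i))[i - φ (b i)]'(hlt i), φ, hmono,
    ?_, ?_, hstart, ?_, ?_⟩
  · exact hstart 0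
  · intro i
    have hstep := h2 (b i) (i - φ (b i)) (hlt i)
    have h1i := hb1 i
    by_cases hi : i + 1 < φ (b i + 1)
    · have hbi := huniq (i + 1) (b i) (by omega) hi
      simp only [hbi]
      rwa [Nat.sub_add_comm h1i]
    · have hi' : i + 1 = φ (b i + 1) := by have := hb2 i; omega
      have hlen : i - φ (b i) + 1 = (l (b i)).length := by have := hsucc (b i); omega
      rw [hlen, h1] at hstep
      have hs := hstart (b i + 1)
      rw [← hi'] at hs
      show R _ _ (t (b (i + 1)) (i + 1 - φ (b (i + 1))))
      rwa [hs]
  · exact fun i => ⟨b i, hb1 i, hb2 i, List.getElem_mem _⟩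
  · intro k q hq
    obtain ⟨j, hj, rfl⟩ := List.getElem_of_mem hq
    have hbk : b (φ k + j) = k := huniq _ k (by omega) (by rw [hsucc]; omega)
    refine ⟨φ k + j, by omega, ?_⟩
    simp [hbk]

end LabelledPath

/-! ### Terminal prefixes -/

theorem termPrefix_append_inl_isPrefix_append {N T : Type*} (u v z : List (N ⊕ T)) (A : N) :
    termPrefix (u ++ Sum.inl A :: v) <+: termPrefix (u ++ z) := by
  induction u with
  | nil => simp [termPrefix]
  | cons x u ih =>
    cases x
    · simp [termPrefix]
    · simpa [termPrefix] using ih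

theorem termPrefix_map_inr_append {N T : Type*} (w : List T) (x : List (N ⊕ T)) :
    termPrefix (w.map Sum.inr ++ x) = w ++ termPrefix x := by
  induction w with
  | nil => rfl
  | cons a w ih => simp [termPrefix, ih]

theorem MatchesPrefix.mono {T : Type*} {l m : List T} {u : ℕ → T}
    (h : MatchesPrefix m u) (hl : l <+: m) : MatchesPrefix l u := by
  intro k hk
  obtain ⟨r, rfl⟩ := hl
  have := h k (by simp; omega)
  simpa [List.getElem_append_left hk] using this

namespace OmegaPSG

variable {T : Type} {G : OmegaPSG T}

theorem Step.termPrefix_le {p : G.P} {x y : List (G.N ⊕ T)} (h : G.Step p x y) :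
    termPrefix x <+: termPrefix y := by
  obtain ⟨u, v, rfl, rfl⟩ := h
  obtain ⟨A, l, hl⟩ := List.exists_cons_of_ne_nil (G.lhs_ne p)
  simpa [hl] using termPrefix_append_inl_isPrefix_append u (l.map Sum.inl ++ v) (G.rhs p ++ v) A

theorem termPrefix_mono {s : ℕ → List (G.N ⊕ T)} {d : ℕ → G.P}
    (h : ∀ i, G.Step (d i) (s i) (s (i + 1))) {i j : ℕ} (hij : i ≤ j) :
    termPrefix (s i) <+: termPrefix (s j) := by
  induction j, hij using Nat.le_induction with
  | base => exact List.prefix_rfl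
  | succ j _ ih => exact ih.trans (h j).termPrefix_le

/-- If only productions in `Q` increase a weight that counts every terminal, then `Q` is used
infinitely often in a derivation of an ω-word. -/
theorem exists_le_mem_of_weight (w : G.N ⊕ T → ℕ) (hw : ∀ a, 1 ≤ w (Sum.inr a)) (Q : Set G.P)
    (hQ : ∀ q ∉ Q, ((G.rhs q).map w).sum ≤ (((G.lhs q).map Sum.inl).map w).sum)
    {s : ℕ → List (G.N ⊕ T)} {d : ℕ → G.P} (h : ∀ i, G.Step (d i) (s i) (s (i + 1)))
    (hlen : ∀ n, ∃ i, n ≤ (termPrefix (s i)).length) (n : ℕ) : ∃ m, n ≤ m ∧ d m ∈ Q := by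
  by_contra! hc
  have hbound : ∀ m, n ≤ m → ((s m).map w).sum ≤ ((s n).map w).sum := by
    intro m hm
    induction m, hm using Nat.le_induction with
    | base => exact le_rfl
    | succ m hm ih =>
      obtain ⟨u, v, hx, hy⟩ := h m
      have := hQ (d m) (hc m hm)
      rw [hx] at ih
      rw [hy]
      simp only [List.map_append, List.sum_append] at ih ⊢
      omega
  have hcount : ∀ x : List (G.N ⊕ T), (termPrefix x).length ≤ (x.map w).sum := by
    intro x
    induction x with
    | nil => simp [termPrefix]
    | cons y x ih =>
      cases y with
      | inl A => simp [termPrefix]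
      | inr a =>
        have := hw a
        simp [termPrefix]
        omega
  obtain ⟨i, hi⟩ := hlen (((s n).map w).sum + 1)
  have h1 := (termPrefix_mono h (le_max_left i n)).length_le
  have h2 := hcount (s (max i n))
  have h3 := hbound _ (le_max_right i n)
  omega

end OmegaPSG

/-! ### The construction -/

/-- Symbols of the original grammar, with an additional erasable symbol. -/
inductive Cell (N T : Type) : Type
  | nt (A : N)
  | tm (a : T)
  | eps

/-- Nonterminals of the dollar-boundary grammar. A cell carries the component `b` of the grammar
it belongs to and a flag telling whether it holds a permission to emit a terminal. -/
inductive BoundaryNT (N T : Type) : Type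
  | dollar
  | start
  | cell (b flag : Bool) (X : Cell N T)

/-- Production names of the dollar-boundary grammar. -/
inductive BoundaryProd (P N T : Type) : Type
  | launch (b : Bool)
  | sim (b flag : Bool) (p : P)
  | pass (b : Bool) (X Y : Cell N T)
  | emit (b : Bool) (a : T)
  | erase (b : Bool)

instance {N T : Type} [Finite N] [Finite T] : Finite (Cell N T) :=
  Finite.of_injective (β := N ⊕ T ⊕ Unit)
    (fun | .nt A => .inl A | .tm a => .inr (.inl a) | .eps => .inr (.inr ()))
    (by rintro (_ | _ | _) (_ | _ | _) h <;> simp_all)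

instance {N T : Type} [Finite N] [Finite T] : Finite (BoundaryNT N T) :=
  Finite.of_injective (β := Bool ⊕ Bool × Bool × Cell N T)
    (fun | .dollar => .inl true | .start => .inl false | .cell b f X => .inr (b, f, X))
    (by rintro (_ | _ | _) (_ | _ | _) h <;> simp_all)

instance {P N T : Type} [Finite P] [Finite N] [Finite T] : Finite (BoundaryProd P N T) :=
  Finite.of_injective
    (β := Bool ⊕ (Bool × Bool × P) ⊕ (Bool × Cell N T × Cell N T) ⊕ (Bool × T) ⊕ Bool)
    (fun
      | .launch b => .inl b
      | .sim b f p => .inr (.inl (b, f, p))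
      | .pass b X Y => .inr (.inr (.inl (b, X, Y)))
      | .emit b a => .inr (.inr (.inr (.inl (b, a))))
      | .erase b => .inr (.inr (.inr (.inr b))))
    (by rintro (_ | _ | _ | _ | _) (_ | _ | _ | _ | _) h <;> simp_all)

namespace BoundaryProd

variable {P N T : Type}

/-- The component a production belongs to. -/
def tag : BoundaryProd P N T → Bool
  | launch b => b
  | sim b _ _ => b
  | pass b _ _ => b
  | emit b _ => b
  | erase b => b

/-- The production of the original grammar that is simulated, if any. -/
def origin : BoundaryProd P N T → Option P
  | sim _ _ p => some p
  | _ => none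

theorem origin_eq_some {q : BoundaryProd P N T} {p : P} (h : q.origin = some p) :
    ∃ f, q = sim q.tag f p := by
  cases q <;> simp_all [origin, tag]

end BoundaryProd

/-- The cell representing a symbol. -/
def Cell.ofSymbol {N T : Type} : N ⊕ T → Cell N T
  | .inl A => .nt A
  | .inr a => .tm a

/-- The word represented by a cell. -/
def Cell.toWord {N T : Type} : Cell N T → List (N ⊕ T)
  | .nt A => [.inl A]
  | .tm a => [.inr a]
  | .eps => []

theorem Cell.toWord_ofSymbol {N T : Type} (x : N ⊕ T) : (Cell.ofSymbol x).toWord = [x] := by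
  cases x <;> rfl

/-- Unflagged cells, except for the first one, which has flag `f`. -/
def flagFirst {N T : Type} (b f : Bool) : List (Cell N T) → List (BoundaryNT N T)
  | [] => []
  | X :: l => .cell b f X :: l.map (.cell b false)

namespace OmegaPSG

variable {T : Type} (G : OmegaPSG T)

/-- The productions allowed to create an emission permission in component `b`: all of them
in component `false`, those occurring in an accepting set in component `true`. -/
def Permits (b : Bool) (p : G.P) : Prop := b = true → p ∈ ⋃₀ G.acc

/-- The right-hand side of `p` as a nonempty list of cells. -/
def body (p : G.P) : List (Cell G.N T) :=
  if G.rhs p = [] then [.eps] else (G.rhs p).map Cell.ofSymbol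

/-- Left-hand sides of the dollar-boundary grammar. -/
def boundaryLhs : BoundaryProd G.P G.N T → List (BoundaryNT G.N T)
  | .launch _ => [.start]
  | .sim b _ p => (G.lhs p).map fun A => .cell b false (.nt A)
  | .pass b X Y => [.cell b false X, .cell b true Y]
  | .emit b a => [.dollar, .cell b true (.tm a)]
  | .erase b => [.cell b false .eps]

open Classical in
/-- Right-hand sides of the dollar-boundary grammar. -/
noncomputable def boundaryRhs : BoundaryProd G.P G.N T → List (BoundaryNT G.N T ⊕ T)
  | .launch b => [.inl .dollar, .inl (.cell b false (.nt G.start))]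
  | .sim b f p => (flagFirst b (f && decide (G.Permits b p)) (G.body p)).map .inl
  | .pass b X Y => [.inl (.cell b true X), .inl (.cell b false Y)]
  | .emit _ a => [.inr a, .inl .dollar]
  | .erase b => if ∃ p, G.rhs p = [] then [] else [.inl (.cell b false .eps)]

/-- The accepting sets of the dollar-boundary grammar. Those of the component `false` contain
simulating productions only, hence no set of productions used by a derivation is included
in them. -/
def boundaryAcc : Set (Set (BoundaryProd G.P G.N T)) :=
  {F' | (∃ F ∈ G.acc, F' = {q | q.tag = false ∧ ∃ p ∈ F, q.origin = some p}) ∨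
    (∀ q ∈ F', q.tag = true) ∧ {p | ∃ q ∈ F', q.origin = some p} ∈ G.acc}

/-- A dollar-boundary grammar consisting of two components that simulate `G`, one for the
acceptance relation `⊓`, the other for `⊆` and `=`. -/
noncomputable abbrev boundaryGrammar [Fintype T] : OmegaPSG T where
  N := BoundaryNT G.N T
  fintypeN := Fintype.ofFinite _
  P := BoundaryProd G.P G.N T
  fintypeP := Fintype.ofFinite _
  lhs := G.boundaryLhs
  lhs_ne q := by cases q <;> simp [boundaryLhs, G.lhs_ne]
  rhs := G.boundaryRhs
  start := .start
  acc := G.boundaryAcc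

variable {G}

theorem body_ne_nil (p : G.P) : G.body p ≠ [] := by
  unfold body
  split_ifs with h <;> simp [h]

theorem length_rhs_le_length_body (p : G.P) : (G.rhs p).length ≤ (G.body p).length := by
  unfold body
  split_ifs with h <;> simp [h]

theorem length_flagFirst {N : Type} (b f : Bool) (l : List (Cell N T)) :
    (flagFirst b f l).length = l.length := by
  cases l <;> simp [flagFirst]

theorem exists_cell_of_mem_flagFirst {N : Type} {b f : Bool} {l : List (Cell N T)}
    {X : BoundaryNT N T} (h : X ∈ flagFirst b f l) : ∃ f' Y, X = .cell b f' Y := by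
  cases l with
  | nil => simp [flagFirst] at h
  | cons Y l =>
    simp only [flagFirst, List.mem_cons, List.mem_map] at h
    obtain rfl | ⟨Z, -, rfl⟩ := h
    exacts [⟨_, _, rfl⟩, ⟨_, _, rfl⟩]

/-- The form of a production of the dollar-boundary grammar, except for erasing productions. -/
theorem boundary_form (q : BoundaryProd G.P G.N T) :
    ((BoundaryNT.dollar ∉ G.boundaryLhs q ∧ BoundaryNT.start ∉ G.boundaryLhs q) ∧
      ∃ β : List (BoundaryNT G.N T), β ≠ [] ∧ BoundaryNT.dollar ∉ β ∧ BoundaryNT.start ∉ β ∧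
        (G.IsCSG → (G.boundaryLhs q).length ≤ β.length) ∧
        G.boundaryRhs q = β.map Sum.inl) ∨
    (G.boundaryLhs q = [BoundaryNT.start] ∧ ∃ α : List (BoundaryNT G.N T), α ≠ [] ∧
      BoundaryNT.dollar ∉ α ∧ BoundaryNT.start ∉ α ∧
      G.boundaryRhs q = Sum.inl BoundaryNT.dollar :: α.map Sum.inl) ∨
    (∃ A : BoundaryNT G.N T, A ≠ .dollar ∧ A ≠ .start ∧
      G.boundaryLhs q = [BoundaryNT.dollar, A] ∧
      ∃ a : T, G.boundaryRhs q = [Sum.inr a, Sum.inl BoundaryNT.dollar]) ∨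
    (¬ G.IsCSG ∧ ∃ A : BoundaryNT G.N T, A ≠ .dollar ∧ A ≠ .start ∧
      G.boundaryLhs q = [A] ∧ G.boundaryRhs q = []) := by
  classical
  rcases q with b | ⟨b, f, p⟩ | ⟨b, X, Y⟩ | ⟨b, a⟩ | b
  · exact .inr (.inl ⟨rfl, [.cell b false (.nt G.start)], by simp, by simp, by simp, rfl⟩)
  · refine .inl ⟨by simp [boundaryLhs], _, ?_, ?_, ?_, ?_, rfl⟩
    · rw [← List.length_pos_iff, length_flagFirst, List.length_pos_iff]
      exact body_ne_nil p
    · intro h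
      obtain ⟨_, _, h⟩ := exists_cell_of_mem_flagFirst h
      cases h
    · intro h
      obtain ⟨_, _, h⟩ := exists_cell_of_mem_flagFirst h
      cases h
    · intro hG
      simpa [boundaryLhs, length_flagFirst] using (hG p).trans (length_rhs_le_length_body p)
  · exact .inl ⟨by simp [boundaryLhs], [.cell b true X, .cell b false Y], by simp, by simp,
      by simp, by simp [boundaryLhs], rfl⟩
  · exact .inr (.inr (.inl ⟨.cell b true (.tm a), by simp, by simp, rfl, a, rfl⟩))
  · by_cases h : ∃ p, G.rhs p = []
    · refine .inr (.inr (.inr ⟨?_, .cell b false .eps, by simp, by simp, rfl, if_pos h⟩))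
      obtain ⟨p, hp⟩ := h
      intro hG
      have := hG p
      simp [hp, G.lhs_ne] at this
    · exact .inl ⟨by simp [boundaryLhs], [.cell b false .eps], by simp, by simp, by simp,
        by simp [boundaryLhs], if_neg h⟩

variable [Fintype T]

theorem boundaryGrammar_hasDollarBoundary :
    G.boundaryGrammar.HasDollarBoundary BoundaryNT.dollar BoundaryNT.start := by
  refine ⟨by simp, rfl, fun q => ?_⟩
  rcases boundary_form q with ⟨h, β, h1, h2, h3, -, h4⟩ | h | h | h
  · exact .inl ⟨h, β, h1, h2, h3, h4⟩
  · exact .inr (.inl h)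
  · exact .inr (.inr (.inl h))
  · exact .inr (.inr (.inr h.2))

theorem IsCSG.boundaryGrammar_hasDollarBoundaryCSG (hG : G.IsCSG) :
    G.boundaryGrammar.HasDollarBoundaryCSG BoundaryNT.dollar BoundaryNT.start := by
  refine ⟨by simp, rfl, fun q => ?_⟩
  rcases boundary_form q with ⟨h, β, h1, h2, h3, h5, h4⟩ | h | h | h
  · exact .inl ⟨h, β, h1, h2, h3, h5 hG, h4⟩
  · exact .inr (.inl h)
  · exact .inr (.inr h)
  · exact absurd hG h.1

end OmegaPSG

namespace OmegaPSG

variable {T : Type}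

/-- `s` is a derivation of the ω-word `u` with production sequence `d`. -/
structure Derivation (G : OmegaPSG T) (u : ℕ → T) (s : ℕ → List (G.N ⊕ T)) (d : ℕ → G.P) :
    Prop where
  zero : s 0 = [Sum.inl G.start]
  step : ∀ i, G.Step (d i) (s i) (s (i + 1))
  unbounded : ∀ n, ∃ i, n ≤ (termPrefix (s i)).length
  matchesPrefix : ∀ i, MatchesPrefix (termPrefix (s i)) u

theorem mem_Lang_iff {G : OmegaPSG T} {σ : AccSigma} {ρ : AccRho} {u : ℕ → T} :
    u ∈ G.Lang σ ρ .nl ↔ ∃ s d, G.Derivation u s d ∧ IsAccepting σ ρ G.acc d :=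
  ⟨fun ⟨s, d, h0, h1, h2, h3, h4⟩ => ⟨s, d, ⟨h0, h1, h2, h3⟩, h4⟩,
    fun ⟨s, d, ⟨h0, h1, h2, h3⟩, h4⟩ => ⟨s, d, h0, h1, h2, h3, h4⟩⟩

variable {G : OmegaPSG T}

/-! ### From the dollar-boundary grammar to the original grammar -/

/-- The word over the original symbols represented by a symbol. -/
def projSymbol (G : OmegaPSG T) : BoundaryNT G.N T ⊕ T → List (G.N ⊕ T)
  | .inl .dollar => []
  | .inl .start => [.inl G.start]
  | .inl (.cell _ _ X) => X.toWord
  | .inr a => [.inr a]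

/-- The sentential form of the original grammar represented by a sentential form. -/
def proj (G : OmegaPSG T) (x : List (BoundaryNT G.N T ⊕ T)) : List (G.N ⊕ T) :=
  x.flatMap G.projSymbol

theorem proj_append (x y : List (BoundaryNT G.N T ⊕ T)) :
    G.proj (x ++ y) = G.proj x ++ G.proj y :=
  List.flatMap_append

theorem proj_flagFirst (b f : Bool) (l : List (Cell G.N T)) :
    G.proj ((flagFirst b f l).map Sum.inl) = l.flatMap Cell.toWord := by
  cases l with
  | nil => rfl
  | cons X l => simp [proj, flagFirst, projSymbol, List.flatMap_map]

theorem flatMap_toWord_body (p : G.P) : (G.body p).flatMap Cell.toWord = G.rhs p := by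
  unfold body
  split_ifs with h
  · simp [Cell.toWord, h]
  · simp [List.flatMap_map, Cell.toWord_ofSymbol]

theorem proj_rhs_eq_proj_lhs {q : BoundaryProd G.P G.N T} (h : q.origin = none) :
    G.proj (G.boundaryRhs q) = G.proj ((G.boundaryLhs q).map Sum.inl) := by
  cases q with
  | sim => simp [BoundaryProd.origin] at h
  | erase b =>
    simp only [boundaryRhs, boundaryLhs]
    split_ifs <;> simp [proj, projSymbol, Cell.toWord]
  | _ => simp [boundaryRhs, boundaryLhs, proj, projSymbol, Cell.toWord]

theorem termPrefix_isPrefix_termPrefix_proj (x : List (BoundaryNT G.N T ⊕ T)) :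
    termPrefix x <+: termPrefix (G.proj x) := by
  induction x with
  | nil => simp [termPrefix]
  | cons y x ih =>
    cases y with
    | inl A => simp [termPrefix]
    | inr a => simpa [termPrefix, proj, projSymbol] using ih

theorem Step.exists_rest {p : G.P} {x y r : List (G.N ⊕ T)} {w : List T}
    (h : G.Step p x y) (hx : x = w.map Sum.inr ++ r) :
    ∃ u v, r = u ++ (G.lhs p).map Sum.inl ++ v ∧ y = w.map Sum.inr ++ (u ++ G.rhs p ++ v) := by
  obtain ⟨u, v, rfl, rfl⟩ := h
  rw [List.append_assoc, List.append_eq_append_iff] at hx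
  obtain ⟨A, l, hl⟩ := List.exists_cons_of_ne_nil (G.lhs_ne p)
  rcases hx with ⟨t, ht, htr⟩ | ⟨t, rfl, rfl⟩
  · cases t with
    | nil =>
      refine ⟨[], v, by simpa using htr.symm, ?_⟩
      simp at ht
      simp [ht]
    | cons c t =>
      have hc : c ∈ w.map (Sum.inr (α := G.N)) := by simp [ht]
      obtain ⟨a, -, rfl⟩ := List.mem_map.mp hc
      simp [hl] at htr
  · exact ⟨t, v, by simp, by simp⟩

section

variable [Fintype T]

theorem proj_eq_of_step {q : BoundaryProd G.P G.N T} {x y : List (BoundaryNT G.N T ⊕ T)}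
    (h : G.boundaryGrammar.Step q x y) (hq : q.origin = none) : G.proj y = G.proj x := by
  obtain ⟨u, v, rfl, rfl⟩ := h
  simp only [proj_append, proj_rhs_eq_proj_lhs hq]

theorem step_proj_of_step {q : BoundaryProd G.P G.N T} {x y : List (BoundaryNT G.N T ⊕ T)}
    {p : G.P} (h : G.boundaryGrammar.Step q x y) (hq : q.origin = some p) :
    G.Step p (G.proj x) (G.proj y) := by
  obtain ⟨u, v, rfl, rfl⟩ := h
  obtain ⟨f, hf⟩ := BoundaryProd.origin_eq_some hq
  refine ⟨G.proj u, G.proj v, ?_, ?_⟩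
  · rw [hf, proj_append, proj_append]
    simp [proj, boundaryLhs, projSymbol, List.flatMap_map, Cell.toWord, ← List.map_eq_flatMap]
  · rw [hf, proj_append, proj_append]
    simp only [boundaryRhs]
    rw [proj_flagFirst, flatMap_toWord_body]

/-- A derivation of the dollar-boundary grammar stays within one of its components. -/
theorem Derivation.exists_tag {u : ℕ → T} {s : ℕ → List (BoundaryNT G.N T ⊕ T)}
    {d : ℕ → BoundaryProd G.P G.N T} (h : G.boundaryGrammar.Derivation u s d) :
    ∃ b, ∀ i, (d i).tag = b := by
  obtain ⟨b, hb⟩ : ∃ b, d 0 = .launch b := by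
    obtain ⟨v, w, hx, -⟩ := h.step 0
    rw [h.zero] at hx
    have hmem : ∀ A ∈ G.boundaryLhs (d 0), A = .start := by
      intro A hA
      have : (Sum.inl A : BoundaryNT G.N T ⊕ T) ∈ [Sum.inl BoundaryNT.start] := by
        rw [hx]
        simp [hA]
      simpa using this
    cases hq : d 0 with
    | launch b => exact ⟨b, rfl⟩
    | sim b f p =>
      obtain ⟨A, l, hl⟩ := List.exists_cons_of_ne_nil (G.lhs_ne p)
      simp [hq, boundaryLhs, hl] at hmem
    | _ => simp [hq, boundaryLhs] at hmem
  have key : ∀ q : BoundaryProd G.P G.N T,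
      (∀ A ∈ G.boundaryLhs q, A = .dollar ∨ ∃ f X, A = .cell b f X) →
      q.tag = b ∧ ∀ A, Sum.inl A ∈ G.boundaryRhs q → A = .dollar ∨ ∃ f X, A = .cell b f X := by
    intro q hq
    cases q with
    | sim c f p =>
      obtain ⟨A, l, hl⟩ := List.exists_cons_of_ne_nil (G.lhs_ne p)
      obtain rfl : c = b := by
        have := hq (.cell c false (.nt A)) (by simp [boundaryLhs, hl])
        simpa using this
      refine ⟨rfl, fun A hA => ?_⟩
      simp only [boundaryRhs, List.mem_map, Sum.inl.injEq, exists_eq_right] at hA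
      exact .inr (exists_cell_of_mem_flagFirst hA)
    | erase c =>
      obtain rfl : c = b := by simpa [boundaryLhs] using hq
      refine ⟨rfl, fun A hA => ?_⟩
      simp only [boundaryRhs] at hA
      split_ifs at hA <;> simp_all
    | launch c => simp [boundaryLhs] at hq
    | pass c X Y =>
      obtain rfl : c = b := by simpa [boundaryLhs] using hq
      simp [BoundaryProd.tag, boundaryRhs]
    | emit c a =>
      obtain rfl : c = b := by simpa [boundaryLhs] using hq
      simp [BoundaryProd.tag, boundaryRhs]
  have hinv : ∀ i, ∀ A, Sum.inl A ∈ s (i + 1) → A = .dollar ∨ ∃ f X, A = .cell b f X := by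
    intro i
    induction i with
    | zero =>
      obtain ⟨v, w, hx, hy⟩ := h.step 0
      rw [h.zero, hb] at hx
      have hx' : [Sum.inl BoundaryNT.start] =
        v ++ (([Sum.inl BoundaryNT.start] : List (BoundaryNT G.N T ⊕ T)) ++ w) := by
        simpa [boundaryLhs] using hx
      have hlen := congrArg List.length hx'
      simp at hlen
      have hv : v = [] := List.length_eq_zero_iff.mp (by omega)
      have hw : w = [] := List.length_eq_zero_iff.mp (by omega)
      intro A hA
      rw [hy, hb, hv, hw] at hA
      simp [boundaryRhs] at hA
      rcases hA with rfl | rfl <;> simp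
    | succ i ih =>
      obtain ⟨v, w, hx, hy⟩ := h.step (i + 1)
      intro A hA
      rw [hy] at hA
      rcases List.mem_append.mp hA with hA | hA
      · rcases List.mem_append.mp hA with hA | hA
        · exact ih A (by rw [hx]; simp [hA])
        · exact (key _ fun B hB => ih B (by rw [hx]; simp [hB])).2 A hA
      · exact ih A (by rw [hx]; simp [hA])
  refine ⟨b, ?_⟩
  rintro (_ | i)
  · simp [hb, BoundaryProd.tag]
  · obtain ⟨v, w, hx, -⟩ := h.step (i + 1)
    exact (key _ fun B hB => hinv i B (by rw [hx]; simp [hB])).1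

theorem Derivation.exists_le_emit {u : ℕ → T} {s : ℕ → List (BoundaryNT G.N T ⊕ T)}
    {d : ℕ → BoundaryProd G.P G.N T} (h : G.boundaryGrammar.Derivation u s d) (n : ℕ) :
    ∃ m, n ≤ m ∧ ∃ b a, d m = .emit b a := by
  refine exists_le_mem_of_weight (G := G.boundaryGrammar) (Sum.elim (fun _ => 0) fun _ => 1)
    (fun _ => le_rfl) {q | ∃ b a, q = .emit b a} ?_ h.step h.unbounded n
  intro q hq
  cases q with
  | emit b a => exact absurd ⟨b, a, rfl⟩ hq
  | erase b =>
    simp only [boundaryRhs]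
    split_ifs <;> simp
  | _ => simp [boundaryRhs]

/-- The number of terminals and emission permissions of a symbol. -/
def permissionWeight {N : Type} : BoundaryNT N T ⊕ T → ℕ
  | .inl (.cell _ true _) => 1
  | .inl _ => 0
  | .inr _ => 1

theorem Derivation.exists_le_permits {u : ℕ → T} {s : ℕ → List (BoundaryNT G.N T ⊕ T)}
    {d : ℕ → BoundaryProd G.P G.N T} (h : G.boundaryGrammar.Derivation u s d) (n : ℕ) :
    ∃ m, n ≤ m ∧ ∃ p, (d m).origin = some p ∧ G.Permits (d m).tag p := by
  refine exists_le_mem_of_weight (G := G.boundaryGrammar) permissionWeight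
    (fun _ => le_rfl) {q | ∃ p, q.origin = some p ∧ G.Permits q.tag p} ?_ h.step h.unbounded n
  intro q hq
  cases q with
  | sim b f p =>
    have hp : ¬ G.Permits b p := fun hp => hq ⟨p, rfl, hp⟩
    obtain ⟨X, l, hl⟩ := List.exists_cons_of_ne_nil (body_ne_nil p)
    simp [boundaryRhs, hp, hl, flagFirst, permissionWeight, Function.comp_def]
  | erase b =>
    simp only [boundaryRhs]
    split_ifs <;> simp [permissionWeight, boundaryLhs]
  | _ => simp [boundaryRhs, boundaryLhs, permissionWeight]

theorem Derivation.exists_original {u : ℕ → T} {s : ℕ → List (BoundaryNT G.N T ⊕ T)}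
    {d : ℕ → BoundaryProd G.P G.N T} (h : G.boundaryGrammar.Derivation u s d) :
    ∃ s' d', G.Derivation u s' d' ∧ SameTrace BoundaryProd.origin d d' := by
  obtain ⟨φ, g, hφ, h0, hstep, htrace⟩ := exists_subsequence BoundaryProd.origin G.Step
    (fun i => G.proj (s i)) d (fun i hi => proj_eq_of_step (h.step i) hi)
    (fun i p hp => step_proj_of_step (h.step i) hp) (fun n => by
      obtain ⟨m, hm, p, hp, -⟩ := h.exists_le_permits n
      exact ⟨m, hm, by simp [hp]⟩)
  have hlong : ∀ n, ∃ k, ∃ l, l <+: termPrefix (G.proj (s (φ k))) ∧ n ≤ l.length ∧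
      MatchesPrefix l u ∧ n ≤ k := by
    intro n
    obtain ⟨i, hi⟩ := h.unbounded n
    have hle : i ≤ φ (max i n) := (le_max_left i n).trans (hφ.id_le _)
    exact ⟨max i n, termPrefix (s (φ (max i n))), termPrefix_isPrefix_termPrefix_proj _,
      hi.trans (termPrefix_mono h.step hle).length_le, h.matchesPrefix _,
      le_max_right i n⟩
  refine ⟨fun k => G.proj (s (φ k)), g, ⟨?_, hstep, ?_, ?_⟩, htrace⟩
  · rw [h0, h.zero]
    rfl
  · intro n
    obtain ⟨k, l, hl, hn, -, -⟩ := hlong n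
    exact ⟨k, hn.trans hl.length_le⟩
  · intro k
    obtain ⟨j, l, hl, hn, hm, hk⟩ := hlong (max k (termPrefix (G.proj (s (φ k)))).length)
    exact hm.mono (List.prefix_of_prefix_length_le
      (termPrefix_mono hstep ((le_max_left _ _).trans hk)) hl
      ((le_max_right _ _).trans hn))

/-! ### From the original grammar to the dollar-boundary grammar -/

/-- The sentential form of component `b` in which `w` has been emitted and the rest of the
original sentential form is `r`. -/
def encode {N : Type} (b : Bool) (w : List T) (r : List (N ⊕ T)) : List (BoundaryNT N T ⊕ T) :=
  w.map Sum.inr ++ Sum.inl .dollar :: r.map fun x => Sum.inl (.cell b false (.ofSymbol x))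

theorem path_pass (b : Bool) (Y : Cell G.N T) (us : List (G.N ⊕ T)) (x : G.N ⊕ T)
    (A B : List (BoundaryNT G.N T ⊕ T)) :
    ∃ l : List (BoundaryProd G.P G.N T), (∀ q ∈ l, q.tag = b ∧ q.origin = none) ∧
      LabelledPath G.boundaryGrammar.Step
        (A ++ (x :: us).map (fun x => Sum.inl (.cell b false (.ofSymbol x))) ++
          Sum.inl (.cell b true Y) :: B) l
        (A ++ Sum.inl (.cell b true (.ofSymbol x)) ::
          us.map (fun x => Sum.inl (.cell b false (.ofSymbol x))) ++
          Sum.inl (.cell b false Y) :: B) := by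
  induction us generalizing x A with
  | nil =>
    refine ⟨[.pass b (.ofSymbol x) Y], by simp [BoundaryProd.tag, BoundaryProd.origin], .single ?_⟩
    exact ⟨A, B, by simp [boundaryLhs], by simp [boundaryRhs]⟩
  | cons y us ih =>
    obtain ⟨l, hl, hpath⟩ := ih y (A ++ [Sum.inl (.cell b false (.ofSymbol x))])
    refine ⟨l ++ [.pass b (.ofSymbol x) (.ofSymbol y)], ?_, ?_⟩
    · intro q hq
      rcases List.mem_append.mp hq with hq | hq
      · exact hl q hq
      · obtain rfl := List.mem_singleton.mp hq
        exact ⟨rfl, rfl⟩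
    · refine LabelledPath.append (y := A ++ Sum.inl (.cell b false (.ofSymbol x)) ::
        Sum.inl (.cell b true (.ofSymbol y)) ::
          us.map (fun x => Sum.inl (.cell b false (.ofSymbol x))) ++
        Sum.inl (.cell b false Y) :: B) ?_ (.single ⟨A,
          us.map (fun x => Sum.inl (.cell b false (.ofSymbol x))) ++
            Sum.inl (.cell b false Y) :: B, ?_, ?_⟩)
      · simpa using hpath
      · simp [boundaryLhs]
      · simp [boundaryRhs]

theorem path_erase (b : Bool) (p : G.P) (A B : List (BoundaryNT G.N T ⊕ T)) :
    ∃ l : List (BoundaryProd G.P G.N T), (∀ q ∈ l, q.tag = b ∧ q.origin = none) ∧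
      LabelledPath G.boundaryGrammar.Step
        (A ++ (flagFirst b false (G.body p)).map Sum.inl ++ B) l
        (A ++ (G.rhs p).map (fun x => Sum.inl (.cell b false (.ofSymbol x))) ++ B) := by
  by_cases h : G.rhs p = []
  · refine ⟨[.erase b], by simp [BoundaryProd.tag, BoundaryProd.origin], .single ⟨A, B, ?_, ?_⟩⟩
    · simp [boundaryLhs, body, h, flagFirst]
    · have : ∃ p, G.rhs p = [] := ⟨p, h⟩
      simp [boundaryRhs, h, this]
  · refine ⟨[], by simp, ?_⟩
    obtain ⟨x, l, hl⟩ := List.exists_cons_of_ne_nil h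
    have : (flagFirst b false (G.body p)).map (Sum.inl (β := T)) =
        (G.rhs p).map (fun x => Sum.inl (.cell b false (.ofSymbol x))) := by
      simp [body, hl, flagFirst]
    rw [this]
    exact .nil _

theorem Step.exists_path (b : Bool) {p : G.P} {x y r : List (G.N ⊕ T)} {w : List T}
    (h : G.Step p x y) (hx : x = w.map Sum.inr ++ r) :
    ∃ w' r', y = w'.map Sum.inr ++ r' ∧ w.length ≤ w'.length ∧
      (G.Permits b p → w.length < (termPrefix x).length → w.length < w'.length) ∧
      ∃ l : List (BoundaryProd G.P G.N T),
        (∀ q ∈ l, q.tag = b ∧ (q.origin = none ∨ q.origin = some p)) ∧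
        (∃ q ∈ l, q.origin = some p) ∧
        LabelledPath G.boundaryGrammar.Step (encode b w r) l (encode b w' r') := by
  obtain ⟨u, v, hr, hy⟩ := h.exists_rest hx
  set c : G.N ⊕ T → BoundaryNT G.N T ⊕ T := fun x => Sum.inl (.cell b false (.ofSymbol x)) with hc
  have hsim : ∀ f, G.boundaryGrammar.Step (.sim b f p) (encode b w r)
      (w.map Sum.inr ++ Sum.inl .dollar :: u.map c ++ G.boundaryRhs (.sim b f p) ++ v.map c) := by
    intro f
    refine ⟨w.map Sum.inr ++ Sum.inl .dollar :: u.map c, v.map c, ?_, rfl⟩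
    simp [encode, hr, boundaryLhs, hc, Function.comp_def, Cell.ofSymbol]
  by_cases hcase : G.Permits b p ∧ w.length < (termPrefix x).length
  · obtain ⟨a, u, rfl⟩ : ∃ a u', u = Sum.inr a :: u' := by
      rcases u with _ | ⟨A | a, u⟩
      · obtain ⟨A, l, hl⟩ := List.exists_cons_of_ne_nil (G.lhs_ne p)
        have := hcase.2
        rw [hx, termPrefix_map_inr_append, hr] at this
        simp [hl, termPrefix] at this
      · have := hcase.2
        rw [hx, termPrefix_map_inr_append, hr] at this
        simp [termPrefix] at this
      · exact ⟨a, u, rfl⟩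
    obtain ⟨X, bd, hbd⟩ := List.exists_cons_of_ne_nil (body_ne_nil p)
    obtain ⟨l₁, hl₁, hp₁⟩ := path_pass (G := G) b X u (Sum.inr a)
      (w.map Sum.inr ++ [Sum.inl .dollar])
      (bd.map (fun X => Sum.inl (.cell b false X)) ++ v.map c)
    obtain ⟨l₂, hl₂, hp₂⟩ := path_erase b p
      (w.map Sum.inr ++ Sum.inr a :: Sum.inl .dollar :: u.map c) (v.map c)
    refine ⟨w ++ [a], u ++ G.rhs p ++ v, by simp [hy], by simp, by simp,
      .sim b true p :: (l₁ ++ (.emit b a :: l₂)), ?_, ⟨_, List.mem_cons_self, rfl⟩, ?_⟩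
    · intro q hq
      simp only [List.mem_cons, List.mem_append] at hq
      rcases hq with rfl | hq | rfl | hq
      · exact ⟨rfl, .inr rfl⟩
      · exact ⟨(hl₁ q hq).1, .inl (hl₁ q hq).2⟩
      · exact ⟨rfl, .inl rfl⟩
      · exact ⟨(hl₂ q hq).1, .inl (hl₂ q hq).2⟩
    · refine .cons (hsim true) (.append (y := w.map Sum.inr ++ [Sum.inl .dollar] ++
        Sum.inl (.cell b true (.tm a)) :: u.map c ++
          Sum.inl (.cell b false X) :: (bd.map (fun X => Sum.inl (.cell b false X)) ++ v.map c))
        ?_ (.cons (y := w.map Sum.inr ++ Sum.inr a :: Sum.inl .dollar :: u.map c ++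
          (flagFirst b false (G.body p)).map Sum.inl ++ v.map c) ?_ ?_))
      · convert hp₁ using 1
        · simp [boundaryRhs, hcase.1, hbd, flagFirst, hc]
        · rfl
      · refine ⟨w.map Sum.inr, u.map c ++ Sum.inl (.cell b false X) ::
          (bd.map (fun X => Sum.inl (.cell b false X)) ++ v.map c), ?_, ?_⟩
        · simp [boundaryLhs]
        · simp [boundaryRhs, hbd, flagFirst]
      · convert hp₂ using 1
        simp [encode, hc]
  · obtain ⟨l, hl, hp⟩ := path_erase b p (w.map Sum.inr ++ Sum.inl .dollar :: u.map c) (v.map c)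
    refine ⟨w, u ++ G.rhs p ++ v, hy, le_rfl, fun h1 h2 => absurd ⟨h1, h2⟩ hcase,
      .sim b false p :: l, ?_, ⟨_, List.mem_cons_self, rfl⟩, ?_⟩
    · intro q hq
      rcases List.mem_cons.mp hq with rfl | hq
      · exact ⟨rfl, .inr rfl⟩
      · exact ⟨(hl q hq).1, .inl (hl q hq).2⟩
    · refine .cons (hsim false) ?_
      convert hp using 1
      · simp [boundaryRhs]
      · simp [encode, hc]

theorem Derivation.exists_boundary (b : Bool) {u : ℕ → T} {s : ℕ → List (G.N ⊕ T)}
    {d : ℕ → G.P} (h : G.Derivation u s d) (hperm : ∀ n, ∃ m, n ≤ m ∧ G.Permits b (d m)) :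
    ∃ s' d', G.boundaryGrammar.Derivation u s' d' ∧ (∀ i, (d' i).tag = b) ∧
      SameTrace BoundaryProd.origin d' d := by
  let State (k : ℕ) := {y : List T × List (G.N ⊕ T) // s k = y.1.map Sum.inr ++ y.2}
  have hnext : ∀ k (y : State k), ∃ y' : State (k + 1), y.1.1.length ≤ y'.1.1.length ∧
      (G.Permits b (d k) → y.1.1.length < (termPrefix (s k)).length →
        y.1.1.length < y'.1.1.length) ∧
      ∃ l : List (BoundaryProd G.P G.N T),
        (∀ q ∈ l, q.tag = b ∧ (q.origin = none ∨ q.origin = some (d k))) ∧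
        (∃ q ∈ l, q.origin = some (d k)) ∧
        LabelledPath G.boundaryGrammar.Step (encode b y.1.1 y.1.2) l
          (encode b y'.1.1 y'.1.2) := by
    intro k y
    obtain ⟨w', r', h1, h2, h3, h4⟩ := (h.step k).exists_path b y.2
    exact ⟨⟨(w', r'), h1⟩, h2, h3, h4⟩
  choose next hle hlt hl using hnext
  let y : ∀ k, State k := fun k => Nat.rec ⟨([], [Sum.inl G.start]), by simpa using h.zero⟩ next k
  have hy : ∀ k, y (k + 1) = next k (y k) := fun k => rfl
  choose l hl₁ hl₂ hl₃ using fun k => hl k (y k)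
  let c : ℕ → List (BoundaryNT G.N T ⊕ T) :=
    fun k => Nat.casesOn k [Sum.inl .start] fun k => encode b (y k).1.1 (y k).1.2
  let lab : ℕ → List (BoundaryProd G.P G.N T) := fun k => Nat.casesOn k [.launch b] l
  obtain ⟨s', d', φ, hφ, h0, hstep, hs', hd', hlab⟩ := LabelledPath.exists_concat
    (R := G.boundaryGrammar.Step) (c := c) (l := lab)
    (by
      rintro (_ | k)
      · exact .single ⟨[], [], by simp [c, boundaryLhs],
          by simp [c, boundaryRhs, y, encode, Cell.ofSymbol]⟩
      · exact hl₃ k)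
    (by
      rintro (_ | k)
      · simp [lab]
      · obtain ⟨q, hq, -⟩ := hl₂ k
        exact List.ne_nil_of_mem hq)
  have htag : ∀ k, ∀ q ∈ lab k, q.tag = b := by
    rintro (_ | k) q hq
    · obtain rfl := List.mem_singleton.mp hq
      rfl
    · exact (hl₁ k q hq).1
  have horigin : ∀ i p, (d' i).origin = some p → ∃ k, i < φ (k + 2) ∧ d k = p := by
    intro i p hp
    obtain ⟨k, -, hi, hk⟩ := hd' i
    rcases k with _ | k
    · rw [List.mem_singleton.mp hk] at hp
      cases hp
    · refine ⟨k, hi, ?_⟩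
      rcases (hl₁ k _ hk).2 with h' | h' <;> simp_all
  have hsim : ∀ k, ∃ i, φ (k + 1) ≤ i ∧ (d' i).origin = some (d k) := by
    intro k
    obtain ⟨q, hq, hqk⟩ := hl₂ k
    obtain ⟨i, hi, rfl⟩ := hlab (k + 1) q hq
    exact ⟨i, hi, hqk⟩
  have hemitted : ∀ k, termPrefix (c (k + 1)) = (y k).1.1 := by
    intro k
    simp [c, encode, termPrefix_map_inr_append, termPrefix]
  have hmono : Monotone fun k => (y k).1.1.length := monotone_nat_of_le_succ fun k => by
    simpa [hy] using hle k (y k)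
  have hgrow : ∀ n, ∃ k, n ≤ (y k).1.1.length := by
    intro n
    induction n with
    | zero => exact ⟨0, Nat.zero_le _⟩
    | succ n ih =>
      obtain ⟨k, hk⟩ := ih
      obtain ⟨i, hi⟩ := h.unbounded (n + 1)
      obtain ⟨m, hm, hp⟩ := hperm (max k i)
      have h1 : n ≤ (y m).1.1.length := hk.trans (hmono ((le_max_left k i).trans hm))
      have h2 := (termPrefix_mono h.step ((le_max_right k i).trans hm)).length_le
      by_cases h3 : n < (y m).1.1.length
      · exact ⟨m, h3⟩
      · have := hlt m (y m) hp (by omega)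
        rw [← hy] at this
        exact ⟨m + 1, by omega⟩
  refine ⟨s', d', ⟨h0, hstep, ?_, ?_⟩, ?_, ?_, ?_⟩
  · intro n
    obtain ⟨k, hk⟩ := hgrow n
    exact ⟨φ (k + 1), by rwa [hs', hemitted]⟩
  · intro i
    have hle' : i ≤ φ (i + 1) := (hφ.id_le i).trans (hφ.monotone (Nat.le_succ i))
    refine ((h.matchesPrefix i).mono ?_).mono (termPrefix_mono hstep hle')
    have hyi := congrArg termPrefix (y i).2
    rw [termPrefix_map_inr_append] at hyi
    rw [hs', hemitted]
    exact ⟨_, hyi.symm⟩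
  · intro i
    obtain ⟨k, -, -, hk⟩ := hd' i
    exact htag k _ hk
  · intro p
    constructor
    · rintro ⟨i, hi⟩
      obtain ⟨k, -, hk⟩ := horigin i p hi
      exact ⟨k, hk⟩
    · rintro ⟨k, rfl⟩
      obtain ⟨i, -, hi⟩ := hsim k
      exact ⟨i, hi⟩
  · intro p
    constructor
    · intro hp n
      obtain ⟨i, hi, hip⟩ := hp (φ (n + 1))
      obtain ⟨k, hk, hkp⟩ := horigin i p hip
      have := hφ.lt_iff_lt.mp (hi.trans_lt hk)
      exact ⟨k, by omega, hkp⟩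
    · intro hp n
      obtain ⟨k, hk, rfl⟩ := hp n
      obtain ⟨i, hi, hip⟩ := hsim k
      exact ⟨i, by have := hφ.id_le (k + 1); simp at this; omega, hip⟩

/-! ### Equality of the generated languages -/

theorem boundaryGrammar_Lang_subset (σ : AccSigma) (ρ : AccRho) :
    G.boundaryGrammar.Lang σ ρ .nl ⊆ G.Lang σ ρ .nl := by
  intro u hu
  obtain ⟨s', d', hder', F', hF', hacc⟩ := mem_Lang_iff.mp hu
  obtain ⟨b, htag⟩ := hder'.exists_tag
  obtain ⟨s, d, hder, htrace⟩ := hder'.exists_original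
  refine mem_Lang_iff.mpr ⟨s, d, hder, ?_⟩
  have hσ := htrace.mem_sigmaSet_iff σ
  have htagσ : ∀ q ∈ sigmaSet σ d', q.tag = b := by
    intro q hq
    obtain ⟨i, rfl⟩ := sigmaSet_subset_range σ d' hq
    exact htag i
  obtain ⟨q₀, hq₀, hnone⟩ : ∃ q ∈ sigmaSet σ d', q.origin = none :=
    exists_mem_sigmaSet σ (f := d')
      (R := fun q : BoundaryProd G.P G.N T => q.origin = none) fun n => by
      obtain ⟨m, hm, c, a, he⟩ := hder'.exists_le_emit n
      exact ⟨m, hm, by rw [he]; rfl⟩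
  have hsub : sigmaSet σ d' ⊆ F' → {p | ∃ q ∈ F', q.origin = some p} ∈ G.acc := by
    intro hs
    rcases hF' with ⟨F, -, rfl⟩ | ⟨-, h⟩
    · obtain ⟨-, p, -, hp⟩ := hs hq₀
      rw [hnone] at hp
      cases hp
    · exact h
  cases ρ with
  | cap =>
    cases b with
    | false =>
      obtain ⟨q, hq, hqF⟩ := hacc
      rcases hF' with ⟨F, hF, rfl⟩ | ⟨h1, -⟩
      · obtain ⟨-, p, hpF, hp⟩ := hqF
        exact ⟨F, hF, p, (hσ p).mpr ⟨q, hq, hp⟩, hpF⟩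
      · have := (htagσ q hq).symm.trans (h1 q hqF)
        cases this
    | true =>
      obtain ⟨q, hq, p, hp, hperm⟩ := exists_mem_sigmaSet σ
        (f := d')
        (R := fun q : BoundaryProd G.P G.N T => ∃ p, q.origin = some p ∧ G.Permits q.tag p)
        hder'.exists_le_permits
      obtain ⟨F, hF, hpF⟩ := hperm (htagσ q hq)
      exact ⟨F, hF, p, (hσ p).mpr ⟨q, hq, hp⟩, hpF⟩
  | sub =>
    refine ⟨_, hsub hacc, fun p hp => ?_⟩
    obtain ⟨q, hq, hqp⟩ := (hσ p).mp hp
    exact ⟨q, hacc hq, hqp⟩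
  | eq =>
    have hacc : sigmaSet σ d' = F' := hacc
    refine ⟨_, hsub hacc.subset, Set.ext fun p => ?_⟩
    rw [← hacc]
    exact hσ p

theorem Lang_subset_boundaryGrammar_Lang (σ : AccSigma) (ρ : AccRho) :
    G.Lang σ ρ .nl ⊆ G.boundaryGrammar.Lang σ ρ .nl := by
  intro u hu
  obtain ⟨s, d, hder, F, hF, hacc⟩ := mem_Lang_iff.mp hu
  have hperm : sigmaSet σ d ⊆ F → ∀ n, ∃ m, n ≤ m ∧ G.Permits true (d m) := by
    intro hs
    obtain ⟨p, hp, -⟩ := exists_mem_sigmaSet_inf (f := d) (R := fun _ => True)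
      fun n => ⟨n, le_rfl, trivial⟩
    have hpσ : p ∈ sigmaSet σ d := by
      cases σ
      · exact sigmaSet_inf_subset_range d hp
      · exact hp
    intro n
    obtain ⟨m, hm, rfl⟩ := hp n
    exact ⟨m, hm, fun _ => ⟨F, hF, hs hpσ⟩⟩
  cases ρ with
  | cap =>
    obtain ⟨s', d', hder', htag, htrace⟩ := hder.exists_boundary false
      fun n => ⟨n, le_rfl, fun h => by cases h⟩
    obtain ⟨p, hp, hpF⟩ := hacc
    obtain ⟨q, hq, hqp⟩ := (htrace.mem_sigmaSet_iff σ p).mp hp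
    obtain ⟨i, rfl⟩ := sigmaSet_subset_range σ d' hq
    exact mem_Lang_iff.mpr ⟨s', d', hder', _, .inl ⟨F, hF, rfl⟩, d' i, hq, htag i, p, hpF, hqp⟩
  | sub =>
    obtain ⟨s', d', hder', htag, htrace⟩ := hder.exists_boundary true (hperm hacc)
    refine mem_Lang_iff.mpr ⟨s', d', hder',
      {q | q.tag = true ∧ ∀ p, q.origin = some p → p ∈ F}, .inr ⟨fun q hq => hq.1, ?_⟩, ?_⟩
    · convert hF using 1
      ext p
      constructor
      · rintro ⟨q, ⟨-, hq⟩, hp⟩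
        exact hq p hp
      · intro hp
        refine ⟨.sim true true p, ⟨rfl, ?_⟩, rfl⟩
        rintro p' ⟨⟩
        exact hp
    · intro q hq
      obtain ⟨i, rfl⟩ := sigmaSet_subset_range σ d' hq
      exact ⟨htag i, fun p hp => hacc ((htrace.mem_sigmaSet_iff σ p).mpr ⟨_, hq, hp⟩)⟩
  | eq =>
    have hacc : sigmaSet σ d = F := hacc
    obtain ⟨s', d', hder', htag, htrace⟩ := hder.exists_boundary true (hperm hacc.subset)
    refine mem_Lang_iff.mpr ⟨s', d', hder', sigmaSet σ d', .inr ⟨?_, ?_⟩, rfl⟩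
    · intro q hq
      obtain ⟨i, rfl⟩ := sigmaSet_subset_range σ d' hq
      exact htag i
    · convert hF using 1
      rw [← hacc]
      exact Set.ext fun p => (htrace.mem_sigmaSet_iff σ p).symm

theorem Lang_eq_boundaryGrammar_Lang (G : OmegaPSG T) (σ : AccSigma) (ρ : AccRho) :
    G.Lang σ ρ .nl = G.boundaryGrammar.Lang σ ρ .nl :=
  (Lang_subset_boundaryGrammar_Lang σ ρ).antisymm (boundaryGrammar_Lang_subset σ ρ)

end

end OmegaPSG

end OmegaFormal

/-- Lemma: every ω-PSG (resp. ω-CSG) G has a (σ,ρ,nl)-equivalent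
(for all acceptance modes) ω-PSG (resp. ω-CSG) with $-boundary. -/
theorem dollar_boundary_form (T : Type) [Fintype T] :
    (∀ G : OmegaPSG T, ∃ (G' : OmegaPSG T) (dollar S' : G'.N),
      G'.HasDollarBoundary dollar S' ∧
      ∀ (σ : AccSigma) (ρ : AccRho),
        G.Lang σ ρ DerivMode.nl = G'.Lang σ ρ DerivMode.nl) ∧
    (∀ G : OmegaPSG T, G.IsCSG → ∃ (G' : OmegaPSG T) (dollar S' : G'.N),
      G'.HasDollarBoundaryCSG dollar S' ∧
      ∀ (σ : AccSigma) (ρ : AccRho),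
        G.Lang σ ρ DerivMode.nl = G'.Lang σ ρ DerivMode.nl) := by
  exact ⟨fun G => ⟨G.boundaryGrammar, _, _, OmegaPSG.boundaryGrammar_hasDollarBoundary,
      G.Lang_eq_boundaryGrammar_Lang⟩,
    fun G hG => ⟨G.boundaryGrammar, _, _, hG.boundaryGrammar_hasDollarBoundaryCSG,
      G.Lang_eq_boundaryGrammar_Lang⟩⟩
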